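/- Suppose P is a weak hyperdoctrine on C with full weak comprehensions and comprehensive diagonals, such that for every arrow f of C the left adjoint ∃_f is stable under double negation (∃_f = ¬¬∃_f) and the comprehension assignment preserves bottom elements ([{|⊥_A|}] is the bottom element of Wsb(C)(A)). Then the composite ⌊-⌋ ∘ L : Wsb(C) → Wsb(C) of the comprehension arrow with its left adjoint coincides with double negation: it maps every [f] in Wsb(C)(A) to ¬¬[f]. -/

import Mathlib

universe u v w

/-- A category with a chosen terminal object and chosen binary products. -/
structure FPCat : Type (max (u+1) (v+1)) where
  Obj : Type u
  Hom : Obj → Obj → Type v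
  id : (A : Obj) → Hom A A
  comp : {A B C : Obj} → Hom A B → Hom B C → Hom A C
  id_comp : ∀ {A B : Obj} (f : Hom A B), comp (id A) f = f
  comp_id : ∀ {A B : Obj} (f : Hom A B), comp f (id B) = f
  assoc : ∀ {A B C D : Obj} (f : Hom A B) (g : Hom B C) (h : Hom C D),
    comp (comp f g) h = comp f (comp g h)
  unit : Obj
  bang : (A : Obj) → Hom A unit
  bang_uniq : ∀ {A : Obj} (f : Hom A unit), f = bang A
  prod : Obj → Obj → Obj
  p1 : {A B : Obj} → Hom (prod A B) A
  p2 : {A B : Obj} → Hom (prod A B) B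
  pair : {X A B : Obj} → Hom X A → Hom X B → Hom X (prod A B)
  pair_p1 : ∀ {X A B : Obj} (f : Hom X A) (g : Hom X B), comp (pair f g) p1 = f
  pair_p2 : ∀ {X A B : Obj} (f : Hom X A) (g : Hom X B), comp (pair f g) p2 = g
  pair_uniq : ∀ {X A B : Obj} (h : Hom X (prod A B)),
    pair (comp h p1) (comp h p2) = h

namespace FPCat
variable (C : FPCat)

/-- The product of two arrows. -/
def pmap {A B A' B' : C.Obj} (f : C.Hom A A') (g : C.Hom B B') :
    C.Hom (C.prod A B) (C.prod A' B') :=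
  C.pair (C.comp C.p1 f) (C.comp C.p2 g)

/-- The diagonal arrow. -/
def diag (A : C.Obj) : C.Hom A (C.prod A A) := C.pair (C.id A) (C.id A)

/-- The swap arrow. -/
def swap (A B : C.Obj) : C.Hom (C.prod A B) (C.prod B A) := C.pair C.p2 C.p1

/-- Monomorphisms. -/
def Mono {X A : C.Obj} (m : C.Hom X A) : Prop :=
  ∀ {Z : C.Obj} (g h : C.Hom Z X), C.comp g m = C.comp h m → g = h

/-- A weak evaluation arrow, exhibiting `W` as a weak exponential of `B` with `A`. -/
def IsWeakEval {W A B : C.Obj} (ev : C.Hom (C.prod W A) B) : Prop :=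
  ∀ {X : C.Obj} (f : C.Hom (C.prod X A) B),
    ∃ g : C.Hom X W, C.comp (C.pmap g (C.id A)) ev = f

/-- The base category is weakly cartesian closed. -/
def WCC : Prop :=
  ∀ A B : C.Obj, ∃ (W : C.Obj) (ev : C.Hom (C.prod W A) B), C.IsWeakEval ev

/-- A commuting square which is a weak pullback. -/
def IsWpbSquare {A B X W : C.Obj} (f : C.Hom B A) (u : C.Hom X A)
    (q1 : C.Hom W B) (q2 : C.Hom W X) : Prop :=
  C.comp q1 f = C.comp q2 u ∧
  ∀ {V : C.Obj} (v1 : C.Hom V B) (v2 : C.Hom V X), C.comp v1 f = C.comp v2 u →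
    ∃ m : C.Hom V W, C.comp m q1 = v1 ∧ C.comp m q2 = v2

/-- A commuting square which is a (strong) pullback. -/
def IsPbSquare {A B X W : C.Obj} (f : C.Hom B A) (u : C.Hom X A)
    (q1 : C.Hom W B) (q2 : C.Hom W X) : Prop :=
  C.IsWpbSquare f u q1 q2 ∧
  ∀ {V : C.Obj} (m m' : C.Hom V W),
    C.comp m q1 = C.comp m' q1 → C.comp m q2 = C.comp m' q2 → m = m'

/-- A parameterized natural number object. -/
def IsPnno {N : C.Obj} (z : C.Hom C.unit N) (s : C.Hom N N) : Prop :=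
  ∀ {A X : C.Obj} (a : C.Hom A X) (f : C.Hom X X),
    ∃! k : C.Hom (C.prod A N) X,
      C.comp (C.pair (C.id A) (C.comp (C.bang A) z)) k = a ∧
      C.comp (C.pmap (C.id A) s) k = C.comp k f

end FPCat

/-- A weak hyperdoctrine (the weak cartesian closure of the base is
stated separately, as `FPCat.WCC`): an elementary doctrine with Heyting
fibres, Heyting substitution maps, with both adjoints to substitution along
product projections, satisfying the Beck-Chevalley condition. -/
structure WHD (C : FPCat.{u, v}) : Type (max u v (w + 1)) where
  fib : C.Obj → Type w
  [ha : (A : C.Obj) → HeytingAlgebra (fib A)]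
  sub : {A B : C.Obj} → C.Hom A B → fib B → fib A
  sub_id : ∀ {A : C.Obj} (α : fib A), sub (C.id A) α = α
  sub_comp : ∀ {A B D : C.Obj} (f : C.Hom A B) (g : C.Hom B D) (α : fib D),
    sub (C.comp f g) α = sub f (sub g α)
  sub_top : ∀ {A B : C.Obj} (f : C.Hom A B), sub f (⊤ : fib B) = ⊤
  sub_bot : ∀ {A B : C.Obj} (f : C.Hom A B), sub f (⊥ : fib B) = ⊥
  sub_inf : ∀ {A B : C.Obj} (f : C.Hom A B) (α β : fib B),
    sub f (α ⊓ β) = sub f α ⊓ sub f β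
  sub_sup : ∀ {A B : C.Obj} (f : C.Hom A B) (α β : fib B),
    sub f (α ⊔ β) = sub f α ⊔ sub f β
  sub_himp : ∀ {A B : C.Obj} (f : C.Hom A B) (α β : fib B),
    sub f (α ⇨ β) = sub f α ⇨ sub f β
  delta : (A : C.Obj) → fib (C.prod A A)
  delta_adj : ∀ {X A : C.Obj} (α : fib (C.prod X A)) (β : fib (C.prod (C.prod X A) A)),
    (sub C.p1 α ⊓ sub (C.pmap C.p2 (C.id A)) (delta A) ≤ β) ↔
      α ≤ sub (C.pair (C.id (C.prod X A)) C.p2) β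
  ex : {A B : C.Obj} → fib (C.prod A B) → fib A
  all : {A B : C.Obj} → fib (C.prod A B) → fib A
  ex_adj : ∀ {A B : C.Obj} (α : fib (C.prod A B)) (γ : fib A),
    ex α ≤ γ ↔ α ≤ sub C.p1 γ
  all_adj : ∀ {A B : C.Obj} (α : fib (C.prod A B)) (γ : fib A),
    sub C.p1 γ ≤ α ↔ γ ≤ all α
  bc_ex : ∀ {X A B : C.Obj} (f : C.Hom X A) (α : fib (C.prod A B)),
    ex (sub (C.pmap f (C.id B)) α) = sub f (ex α)
  bc_all : ∀ {X A B : C.Obj} (f : C.Hom X A) (α : fib (C.prod A B)),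
    sub f (all α) = all (sub (C.pmap f (C.id B)) α)

attribute [instance] WHD.ha

namespace WHD

variable {C : FPCat} (P : WHD C)

/-- `P` has comprehensive diagonals: two parallel arrows are equal as soon as
they are `P`-provably equal. -/
def CompDiag : Prop :=
  ∀ {X A : C.Obj} (f g : C.Hom X A),
    (⊤ : P.fib X) ≤ P.sub (C.pair f g) (P.delta A) → f = g

/-- `c` is a weak comprehension of `α`. -/
def IsWeakComp {X A : C.Obj} (c : C.Hom X A) (α : P.fib A) : Prop :=
  (⊤ : P.fib X) ≤ P.sub c α ∧
  ∀ {Z : C.Obj} (f : C.Hom Z A), (⊤ : P.fib Z) ≤ P.sub f α →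
    ∃ f' : C.Hom Z X, C.comp f' c = f

/-- `P` has full weak comprehensions. -/
def HasFullWeakComp : Prop :=
  (∀ {A : C.Obj} (α : P.fib A), ∃ (X : C.Obj) (c : C.Hom X A), P.IsWeakComp c α) ∧
  (∀ {A X Y : C.Obj} (α β : P.fib A) (c : C.Hom X A) (d : C.Hom Y A),
    P.IsWeakComp c α → P.IsWeakComp d β → (∃ k : C.Hom X Y, C.comp k d = c) → α ≤ β)

/-- The uniqueness part of `∃!b. R(a,b)`, as a predicate on `a : A`. -/
def uniqRel {A B : C.Obj} (R : P.fib (C.prod A B)) : P.fib A :=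
  P.all (P.all
    ((P.sub C.p1 R ⊓ P.sub (C.pair (C.comp C.p1 C.p1) C.p2) R) ⇨
      P.sub (C.pmap C.p2 (C.id B)) (P.delta B)))

/-- The Axiom of Choice holds on the object `A`:
`∀a:A.∃b:B.R(a,b) ⊢ ∃f:W.∀a:A.R(a, ev(f,a))` for every weak evaluation `ev`. -/
def ACon (A : C.Obj) : Prop :=
  ∀ (B W : C.Obj) (ev : C.Hom (C.prod W A) B), C.IsWeakEval ev →
    ∀ R : P.fib (C.prod A B),
      P.all (A := C.unit) (B := A) (P.sub C.p2 (P.ex R)) ≤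
        P.ex (A := C.unit) (B := W) (P.sub C.p2 (P.all (P.sub (C.pair C.p2 ev) R)))

/-- The Axiom of Unique Choice holds on the object `A`. -/
def AUCon (A : C.Obj) : Prop :=
  ∀ (B W : C.Obj) (ev : C.Hom (C.prod W A) B), C.IsWeakEval ev →
    ∀ R : P.fib (C.prod A B),
      P.all (A := C.unit) (B := A) (P.sub C.p2 (P.ex R ⊓ P.uniqRel R)) ≤
        P.ex (A := C.unit) (B := W) (P.sub C.p2 (P.all (P.sub (C.pair C.p2 ev) R)))

/-- The Axiom of Choice holds in `P`. -/
def AC : Prop := ∀ A : C.Obj, P.ACon A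

/-- The Axiom of Unique Choice holds in `P`. -/
def AUC : Prop := ∀ A : C.Obj, P.AUCon A

/-- The Rule of Choice holds in `P`. -/
def RC : Prop :=
  ∀ {A B : C.Obj} (R : P.fib (C.prod A B)), (⊤ : P.fib A) ≤ P.ex R →
    ∃ f : C.Hom A B, (⊤ : P.fib A) ≤ P.sub (C.pair (C.id A) f) R

/-- A parameterized natural number object `(N, z, s)` satisfies induction in `P`. -/
def SatInd {N : C.Obj} (z : C.Hom C.unit N) (s : C.Hom N N) : Prop :=
  ∀ {A : C.Obj} (φ : P.fib (C.prod A N)),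
    (⊤ : P.fib A) ≤ P.sub (C.pair (C.id A) (C.comp (C.bang A) z)) φ →
    φ ≤ P.sub (C.pmap (C.id A) s) φ →
    (⊤ : P.fib (C.prod A N)) ≤ φ

/-- `P` is an arithmetic doctrine: the base has a pnno which satisfies
induction in `P`. -/
def Arithmetic : Prop :=
  ∃ (N : C.Obj) (z : C.Hom C.unit N) (s : C.Hom N N), C.IsPnno z s ∧ P.SatInd z s

end WHD

namespace WHD

variable {C : FPCat} (P : WHD C)

/-- The left adjoint `∃_f` to substitution along an arbitrary arrow
`f : A → B`, defined as `∃_f(α)(b) = ∃a:A. (f(a) =_B b ∧ α(a))`. -/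
def exf {A B : C.Obj} (f : C.Hom A B) (α : P.fib A) : P.fib B :=
  P.ex (P.sub (C.pair (C.comp C.p2 f) C.p1) (P.delta B) ⊓ P.sub C.p2 α)

end WHD

/-- `[nf] = ¬[f]` in the fibre `Wsb(C)(A)` of the doctrine of variations with
bottom element represented by `bot`, expressed by the universal property of
the pseudo-complement: for every variation `[w]` over `A`,
`[w] ≤ [nf]` iff every common lower bound of `[w]` and `[f]` is below
`[bot]`. -/
def IsVCompl (C : FPCat) {A Xf Xn Xb : C.Obj}
    (nf : C.Hom Xn A) (f : C.Hom Xf A) (bot : C.Hom Xb A) : Prop :=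
  ∀ {V : C.Obj} (w : C.Hom V A),
    (∃ k : C.Hom V Xn, C.comp k nf = w) ↔
    (∀ {U : C.Obj} (m : C.Hom U A),
      (∃ u : C.Hom U V, C.comp u w = m) →
      (∃ u' : C.Hom U Xf, C.comp u' f = m) →
      ∃ kb : C.Hom U Xb, C.comp kb bot = m)

namespace FPCat

variable {C : FPCat}

theorem hom_prod_ext {X A B : C.Obj} {g h : C.Hom X (C.prod A B)}
    (h1 : C.comp g C.p1 = C.comp h C.p1) (h2 : C.comp g C.p2 = C.comp h C.p2) : g = h := by
  rw [← C.pair_uniq g, ← C.pair_uniq h, h1, h2]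

theorem comp_pair {Y X A B : C.Obj} (k : C.Hom Y X) (f : C.Hom X A) (g : C.Hom X B) :
    C.comp k (C.pair f g) = C.pair (C.comp k f) (C.comp k g) := by
  apply hom_prod_ext <;> simp only [C.assoc, C.pair_p1, C.pair_p2]

end FPCat

namespace WHD

variable {C : FPCat} (P : WHD C)

theorem sub_mono {A B : C.Obj} (f : C.Hom A B) {α β : P.fib B} (h : α ≤ β) :
    P.sub f α ≤ P.sub f β := by
  rw [← inf_eq_left, ← P.sub_inf, inf_eq_left.mpr h]

theorem sub_compl {A B : C.Obj} (f : C.Hom A B) (α : P.fib B) :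
    P.sub f αᶜ = (P.sub f α)ᶜ := by
  rw [← himp_bot, ← himp_bot, P.sub_himp, P.sub_bot]

theorem top_le_sub_comp {X Y A : C.Obj} (k : C.Hom X Y) (f : C.Hom Y A) {α : P.fib A}
    (h : ⊤ ≤ P.sub f α) : ⊤ ≤ P.sub (C.comp k f) α := by
  rw [P.sub_comp, ← P.sub_top k]
  exact P.sub_mono k h

/-- Equality is reflexive. -/
theorem top_le_sub_pair_self {X A : C.Obj} (f : C.Hom X A) :
    ⊤ ≤ P.sub (C.pair f f) (P.delta A) := by
  have h := (P.delta_adj (X := A) (A := A) ⊤ _).1 inf_le_right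
  rw [← P.sub_comp] at h
  have h' := P.top_le_sub_comp (C.pair f f) _ h
  have e : C.comp (C.pair f f) (C.comp (C.pair (C.id (C.prod A A)) C.p2)
      (C.pmap C.p2 (C.id A))) = C.pair f f := by
    simp only [FPCat.pmap, FPCat.comp_pair, ← C.assoc, C.pair_p1, C.pair_p2, C.comp_id]
  rwa [e] at h'

/-- The unit of `∃_f ⊣ f*` at `⊤`. -/
theorem top_le_sub_exf_top {X A : C.Obj} (f : C.Hom X A) :
    ⊤ ≤ P.sub f (P.exf f (⊤ : P.fib X)) := by
  have h := P.sub_mono (C.pair f (C.id X)) ((P.ex_adj _ (P.exf f (⊤ : P.fib X))).1 le_rfl)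
  simp only [P.sub_top, inf_top_eq, ← P.sub_comp, FPCat.comp_pair, ← C.assoc, C.pair_p1,
    C.pair_p2, C.id_comp] at h
  exact (P.top_le_sub_pair_self f).trans h

/-- Beck–Chevalley for `∃_f ⊤`. -/
theorem sub_exf_top {X A V : C.Obj} (f : C.Hom X A) (w : C.Hom V A) :
    P.sub w (P.exf f (⊤ : P.fib X)) =
      P.ex (P.sub (C.pair (C.comp C.p2 f) (C.comp C.p1 w)) (P.delta A)) := by
  rw [exf, ← P.bc_ex]
  simp only [P.sub_top, inf_top_eq, ← P.sub_comp, FPCat.comp_pair, FPCat.pmap, ← C.assoc,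
    C.pair_p1, C.pair_p2, C.comp_id]

variable {P}

/-- A predicate whose comprehension lies over the empty predicate is empty. -/
theorem le_bot_of_isWeakComp (hcomp : P.HasFullWeakComp) {A X : C.Obj} {c : C.Hom X A}
    {α : P.fib A} (hc : P.IsWeakComp c α) (h : ⊤ ≤ P.sub c ⊥) : α ≤ ⊥ := by
  obtain ⟨Y, d, hd⟩ := hcomp.1 (⊥ : P.fib A)
  exact hcomp.2 α ⊥ c d hc hd (hd.2 c h)

theorem sub_exf_top_le_bot (hcomp : P.HasFullWeakComp) (hdiag : P.CompDiag)
    {X A V : C.Obj} (f : C.Hom X A) (w : C.Hom V A)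
    (h : ∀ {U : C.Obj} (m : C.Hom U A), (∃ u : C.Hom U V, C.comp u w = m) →
      (∃ u' : C.Hom U X, C.comp u' f = m) → ⊤ ≤ P.sub m ⊥) :
    P.sub w (P.exf f (⊤ : P.fib X)) ≤ ⊥ := by
  rw [P.sub_exf_top, P.ex_adj, P.sub_bot]
  obtain ⟨W, e, he⟩ := hcomp.1
    (P.sub (C.pair (C.comp C.p2 f) (C.comp C.p1 w)) (P.delta A))
  refine le_bot_of_isWeakComp hcomp he ?_
  have heq := he.1
  rw [← P.sub_comp, FPCat.comp_pair, ← C.assoc, ← C.assoc] at heq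
  have := h (C.comp (C.comp e C.p1) w) ⟨_, rfl⟩ ⟨_, hdiag _ _ heq⟩
  rwa [P.sub_bot] at this ⊢

theorem sub_le_bot_of_isWeakComp (hcomp : P.HasFullWeakComp) {A X V : C.Obj}
    {c : C.Hom X A} {α : P.fib A} (hc : P.IsWeakComp c α) (w : C.Hom V A)
    (h : ∀ {U : C.Obj} (m : C.Hom U A), (∃ u : C.Hom U V, C.comp u w = m) →
      (∃ u' : C.Hom U X, C.comp u' c = m) → ⊤ ≤ P.sub m ⊥) :
    P.sub w α ≤ ⊥ := by
  obtain ⟨D, d, hd⟩ := hcomp.1 (P.sub w α)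
  refine le_bot_of_isWeakComp hcomp hd ?_
  have hdw := hd.1
  rw [← P.sub_comp] at hdw
  have := h (C.comp d w) ⟨_, rfl⟩ (hc.2 _ hdw)
  rwa [P.sub_bot] at this ⊢

/-- The comprehension of `¬α` is a pseudo-complement of any variation `f` over `α` such that
a variation disjoint from `f` is disjoint from `α`. -/
theorem isVCompl_of_isWeakComp_compl {A X Xn Xb : C.Obj} {f : C.Hom X A} {n : C.Hom Xn A}
    {cbot : C.Hom Xb A} {α : P.fib A} (hn : P.IsWeakComp n αᶜ) (hb : P.IsWeakComp cbot ⊥)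
    (hf : ⊤ ≤ P.sub f α)
    (hdisj : ∀ {V : C.Obj} (w : C.Hom V A),
      (∀ {U : C.Obj} (m : C.Hom U A), (∃ u : C.Hom U V, C.comp u w = m) →
        (∃ u' : C.Hom U X, C.comp u' f = m) → ⊤ ≤ P.sub m ⊥) → P.sub w α ≤ ⊥) :
    IsVCompl C n f cbot := by
  intro V w
  constructor
  · rintro ⟨k, rfl⟩ U m ⟨u, rfl⟩ ⟨u', hu'⟩
    apply hb.2
    have h1 := P.top_le_sub_comp u _ (P.top_le_sub_comp k n hn.1)
    have h2 := P.top_le_sub_comp u' f hf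
    rw [hu'] at h2
    have h3 := le_inf h2 h1
    rwa [← P.sub_inf, inf_compl_self] at h3
  · intro h
    apply hn.2
    rw [P.sub_compl, ← himp_bot, le_himp_iff, top_inf_eq]
    refine hdisj w fun m hw hf' => ?_
    obtain ⟨k, rfl⟩ := h m hw hf'
    exact P.top_le_sub_comp k cbot hb.1

end WHD

/-- STATEMENT 18.  Suppose `P` is a weak hyperdoctrine on `C` with full weak
comprehensions and comprehensive diagonals, such that the left adjoints `∃_f`
are stable under double negation and the comprehension assignment preserves
bottom elements (`[{|⊥_A|}]` is a bottom element of `Wsb(C)(A)`).  Then the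
composite `⌊-⌋ ∘ L : Wsb(C) → Wsb(C)` coincides with double negation: for
every `[f]` in `Wsb(C)(A)`, the comprehension `c` of `L([f]) = ∃_f(⊤)`
satisfies `[c] = ¬¬[f]`, i.e. there is a variation `[n]` over `A` with
`[n] = ¬[f]` and `[c] = ¬[n]`. -/
theorem comprehension_of_exists_is_double_negation
    (C : FPCat) (hwcc : C.WCC) (P : WHD C)
    (hcomp : P.HasFullWeakComp) (hdiag : P.CompDiag)
    (hstab : ∀ {A B : C.Obj} (f : C.Hom A B) (α : P.fib A),
      (P.exf f α)ᶜᶜ = P.exf f α)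
    (hbot : ∀ {A Xb : C.Obj} (cbot : C.Hom Xb A), P.IsWeakComp cbot (⊥ : P.fib A) →
      ∀ {V : C.Obj} (v : C.Hom V A), ∃ k : C.Hom Xb V, C.comp k v = cbot) :
    ∀ {X A : C.Obj} (f : C.Hom X A) {Xc : C.Obj} (c : C.Hom Xc A),
      P.IsWeakComp c (P.exf f (⊤ : P.fib X)) →
      ∀ {Xb : C.Obj} (cbot : C.Hom Xb A), P.IsWeakComp cbot (⊥ : P.fib A) →
        ∃ (Xn : C.Obj) (n : C.Hom Xn A),
          IsVCompl C n f cbot ∧ IsVCompl C c n cbot := by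
  intro X A f Xc c hc Xb cbot hb
  obtain ⟨Xn, n, hn⟩ := hcomp.1 (P.exf f (⊤ : P.fib X))ᶜ
  refine ⟨Xn, n, WHD.isVCompl_of_isWeakComp_compl hn hb (P.top_le_sub_exf_top f)
    fun w => WHD.sub_exf_top_le_bot hcomp hdiag f w, ?_⟩
  rw [← hstab] at hc
  exact WHD.isVCompl_of_isWeakComp_compl hc hb hn.1
    fun w => WHD.sub_le_bot_of_isWeakComp hcomp hn w
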